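/- Let a, a' ∈ 𝔓₂ be words of the same odd length m with Σ(a') = ±1, and let s, s' be integers with |s| < m/2 and |s'| < m/2. If ρ^{s}(a) = ρ^{s'}(a') and ρ^{−s}(a) = ρ^{−s'}(a'), then s = s' and a = a'. -/

import Mathlib

/-- Integer-indexed cyclic rotation `ρ^t` of a list. -/
def zrot (l : List ℤ) (t : ℤ) : List ℤ := l.rotate (t % (l.length : ℤ)).toNat

/-- The bi-infinite periodic extension of a list. -/
def cyclicExtension (l : List ℤ) (i : ℤ) : ℤ := l.getD (i % (l.length : ℤ)).toNat 0

theorem cyclicExtension_periodic (l : List ℤ) :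
    Function.Periodic (cyclicExtension l) (l.length : ℤ) := fun i => by
  simp [cyclicExtension]

theorem cyclicExtension_zrot (l : List ℤ) (t i : ℤ) :
    cyclicExtension (zrot l t) i = cyclicExtension l (i + t) := by
  rcases l.eq_nil_or_concat' with rfl | ⟨l', x, hl⟩
  · simp [cyclicExtension, zrot]
  have hpos : 0 < (l.length : ℤ) := by simp [hl]
  have hi₀ := Int.emod_nonneg i hpos.ne'
  have hi := Int.emod_lt_of_pos i hpos
  have ht₀ := Int.emod_nonneg t hpos.ne'
  have hit₀ := Int.emod_nonneg (i + t) hpos.ne'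
  have hit := Int.emod_lt_of_pos (i + t) hpos
  have hidx : ((i % (l.length : ℤ)).toNat + (t % (l.length : ℤ)).toNat) % l.length =
      ((i + t) % (l.length : ℤ)).toNat := by
    zify
    rw [Int.toNat_of_nonneg hi₀, Int.toNat_of_nonneg ht₀, Int.toNat_of_nonneg hit₀,
      ← Int.add_emod]
  unfold cyclicExtension zrot
  rw [List.length_rotate, List.getD_eq_getElem _ _ (by rw [List.length_rotate]; omega),
    List.getD_eq_getElem _ _ (by omega), List.getElem_rotate]
  simp only [hidx]

theorem sum_range_cyclicExtension (l : List ℤ) :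
    ∑ i ∈ Finset.range l.length, cyclicExtension l i = l.sum := by
  rw [← Fin.sum_univ_getElem l, Finset.sum_range]
  refine Finset.sum_congr rfl fun i _ => ?_
  have hi : ((i : ℕ) : ℤ) % (l.length : ℤ) = (i : ℕ) := by
    exact_mod_cast Nat.mod_eq_of_lt i.isLt
  simp [cyclicExtension, hi]

theorem Function.Periodic.int_gcd {α : Type*} {f : ℤ → α} {c d : ℤ}
    (hc : Function.Periodic f c) (hd : Function.Periodic f d) :
    Function.Periodic f (Int.gcd c d : ℤ) := by
  rw [Int.gcd_eq_gcd_ab, mul_comm c, mul_comm d]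
  exact (hc.int_mul _).add_period (hd.int_mul _)

theorem Function.Periodic.sum_range_mul {f : ℤ → ℤ} {g : ℕ}
    (hf : Function.Periodic f (g : ℤ)) (k : ℕ) :
    ∑ i ∈ Finset.range (k * g), f i = k * ∑ i ∈ Finset.range g, f i := by
  induction k with
  | zero => simp
  | succ k ih =>
    have hshift (i : ℕ) : f ((k * g + i : ℕ) : ℤ) = f i := by
      push_cast
      rw [add_comm]
      exact hf.nat_mul k i
    rw [Nat.succ_mul, Finset.sum_range_add, ih]
    simp only [hshift]
    push_cast
    ring

theorem length_dvd_of_periodic_of_isUnit_sum {l : List ℤ}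
    (hsum : IsUnit l.sum) {c : ℤ} (hc : Function.Periodic (cyclicExtension l) c) :
    (l.length : ℤ) ∣ c := by
  obtain ⟨k, hk⟩ : Int.gcd (l.length : ℤ) c ∣ l.length := by
    exact_mod_cast Int.gcd_dvd_left (l.length : ℤ) c
  have hsum_eq := ((cyclicExtension_periodic l).int_gcd hc).sum_range_mul k
  rw [mul_comm, ← hk, sum_range_cyclicExtension] at hsum_eq
  have hunit : IsUnit (k : ℤ) := isUnit_of_mul_isUnit_left (hsum_eq ▸ hsum)
  have hk1 : k = 1 := by simpa using Int.isUnit_iff_natAbs_eq.mp hunit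
  rw [hk1, mul_one] at hk
  have hdvd := Int.gcd_dvd_right (l.length : ℤ) c
  rwa [← hk] at hdvd

/-- For words `a, a' ∈ 𝔓₂` of the same odd length `m` with `Σ(a') = ±1`, and
`|s|, |s'| < m/2`: `ρ^s(a) = ρ^{s'}(a')` and `ρ^{−s}(a) = ρ^{−s'}(a')` imply
`s = s'` and `a = a'`. -/
theorem stmt9 (a a' : List ℤ)
    (hwa : ∀ v ∈ a, v = 1 ∨ v = -1) (hwa' : ∀ v ∈ a', v = 1 ∨ v = -1)
    (hlen : a'.length = a.length) (hodd : Odd a.length)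
    (hsum : a'.sum = 1 ∨ a'.sum = -1)
    (s s' : ℤ) (hs : 2 * |s| < (a.length : ℤ)) (hs' : 2 * |s'| < (a.length : ℤ))
    (h1 : zrot a s = zrot a' s') (h2 : zrot a (-s) = zrot a' (-s')) :
    s = s' ∧ a = a' := by
  have hrot (x : ℤ) : cyclicExtension a (x + s) = cyclicExtension a' (x + s') := by
    rw [← cyclicExtension_zrot, h1, cyclicExtension_zrot]
  have hrot_neg (x : ℤ) : cyclicExtension a (x - s) = cyclicExtension a' (x - s') := by
    rw [sub_eq_add_neg, ← cyclicExtension_zrot, h2, cyclicExtension_zrot, sub_eq_add_neg]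
  have hper : Function.Periodic (cyclicExtension a') (2 * (s' - s)) := fun x => by
    have h := (hrot (x + s' - 2 * s)).symm.trans
      ((congrArg (cyclicExtension a) (by ring)).trans (hrot_neg (x + s')))
    convert h using 2 <;> ring
  have hdvd := length_dvd_of_periodic_of_isUnit_sum (Int.isUnit_iff.mpr hsum) hper
  have hcop : IsCoprime (a'.length : ℤ) 2 := by
    rw [hlen]
    exact_mod_cast Nat.isCoprime_iff_coprime.mpr (Nat.coprime_two_right.mpr hodd)
  have hzero : s' - s = 0 := by
    refine Int.eq_zero_of_abs_lt_dvd (hcop.dvd_of_dvd_mul_left hdvd) ?_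
    have := abs_sub s' s
    omega
  obtain rfl : s = s' := by omega
  refine ⟨rfl, ?_⟩
  unfold zrot at h1
  rw [hlen] at h1
  exact List.rotate_injective _ h1
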